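/- Let {φ_t} be an ℓ-independent sequence of ℝ^d-valued random vectors with E[‖φ_t‖^4] ≤ κ < ∞ for all t, and let {ψ_t} be an ℓ-independent sequence of ℝ^d-valued random vectors with E[‖ψ_t‖^4] ≤ κ < ∞ for all t. Assume that for all i, j with |i−j| ≥ ℓ, ψ_i is independent of φ_j and E[ψ_i φ_jᵀ] = 0, and that for all i, j with |i−j| < ℓ and all coordinates k, l, E[ψ_{i,k}^4 φ_{j,l}^4] ≤ κ < ∞. Let {σ_n}_{n≥1} be random permutations, independent of each other and of {ψ_t} and {φ_t}, where σ_n is a uniform random permutation of [n]. Then the d×d random matrix (1/n) ∑_{t=1}^{n} ψ_t φ_{σ_n(t)}ᵀ converges to the zero matrix almost surely as n → ∞. -/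

import Mathlib

open MeasureTheory ProbabilityTheory Filter
open scoped ENNReal NNReal Topology

noncomputable section

/-- A sequence of random elements is `ℓ`-independent if each `X t` is independent
of the joint family `{X k : |t - k| ≥ ℓ}`. -/
def LIndepSeq {Ω E : Type*} [MeasurableSpace Ω] [MeasurableSpace E]
    (ℓ : ℕ) (X : ℕ → Ω → E) (μ : Measure Ω) : Prop :=
  ∀ t : ℕ, IndepFun (X t)
    (fun ω => fun k : {k : ℕ // ℓ ≤ ((t : ℤ) - (k : ℤ)).natAbs} => X (k : ℕ) ω) μ

/-- `σ` is a uniform random permutation of `{0, …, n-1}`: each of the `n!`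
permutations has probability `1/n!`. -/
def IsUniformPerm {Ω : Type*} [MeasurableSpace Ω] {n : ℕ}
    (σ : Ω → Equiv.Perm (Fin n)) (μ : Measure Ω) : Prop :=
  ∀ e : Equiv.Perm (Fin n), μ {ω | σ ω = e} = (Nat.factorial n : ℝ≥0∞)⁻¹

theorem perm_fourth (n : ℕ) (hn : 0 < n) (a b : Fin n → ℝ) :
    ∑ e : Equiv.Perm (Fin n), (∑ t, a t * b (e t) - (n:ℝ)⁻¹ * ((∑ t, a t) * ∑ t, b t)) ^ 4
      ≤ 144 * (n.factorial : ℝ) * ((∑ t, a t ^ 4) * ∑ t, b t ^ 4) := by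
  classical
  have hn' : (0:ℝ) < n := by exact_mod_cast hn
  set m : ℝ := (n:ℝ)⁻¹ * ((∑ t, a t) * ∑ t, b t) with hm
  set g : Equiv.Perm (Fin n) → ℝ := fun e => ∑ t, a t * b (e t) - m with hg
  set D : Equiv.Perm (Fin n) → Fin n → Fin n → ℝ :=
    fun e i j => (a i - a j) * (b (e i) - b (e j)) with hD
  have hswap : ∀ e i j, g (e * Equiv.swap i j) = g e - D e i j := by
    intro e i j
    by_cases hij : i = j
    · subst hij
      have h1 : e * Equiv.swap i i = e := by rw [Equiv.swap_self]; rfl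
      rw [h1]; simp [hD]
    have key : ∑ t, a t * b ((e * Equiv.swap i j) t) - ∑ t, a t * b (e t) = - D e i j := by
      rw [← Finset.sum_sub_distrib, ← Finset.sum_subset (Finset.subset_univ {i, j})]
      · rw [Finset.sum_pair hij]
        simp [hD]; ring
      · intro x _ hx
        simp only [Finset.mem_insert, Finset.mem_singleton, not_or] at hx
        simp [Equiv.swap_apply_of_ne_of_ne hx.1 hx.2]
    simp only [hg]; linarith
  have hDs : ∀ e i j, D (e * Equiv.swap i j) i j = - D e i j := by
    intro e i j; simp [hD]; ring
  have hsumD : ∀ e, ∑ i, ∑ j, D e i j = 2 * n * g e := by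
    intro e
    have hbe : ∑ t, b (e t) = ∑ t, b t := Equiv.sum_comp e b
    have h1 : ∀ i j, D e i j = a i * b (e i) - a i * b (e j) - a j * b (e i) + a j * b (e j) := by
      intro i j; simp only [hD]; ring
    have h2 : ∑ x, a x * ((n:ℝ) * b (e x)) = n * ∑ x, a x * b (e x) := by
      rw [Finset.mul_sum]; exact Finset.sum_congr rfl fun x _ => by ring
    simp only [h1, Finset.sum_add_distrib, Finset.sum_sub_distrib, ← Finset.mul_sum,
      ← Finset.sum_mul, Finset.sum_const, Finset.card_univ, Fintype.card_fin, nsmul_eq_mul, hbe, hg, hm, h2]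
    field_simp
    ring
  have hre : ∀ i j (F : Equiv.Perm (Fin n) → ℝ), ∑ e, F (e * Equiv.swap i j) = ∑ e, F e := by
    intro i j F
    exact Equiv.sum_comp (Equiv.mulRight (Equiv.swap i j)) F
  have hij : ∀ i j, 2 * ∑ e, D e i j * g e ^ 3 ≤ 3 * ∑ e, D e i j ^ 2 * g e ^ 2 := by
    intro i j
    have h1 := hre i j (fun e => D e i j * g e ^ 3)
    have h2 := hre i j (fun e => D e i j ^ 2 * g e ^ 2)
    simp only [hDs, hswap] at h1 h2
    have h3 : ∑ e, D e i j * g e ^ 3 + ∑ e, D e i j * g e ^ 3 ≤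
        ∑ e, (3/2) * (D e i j ^ 2 * g e ^ 2) + ∑ e, (3/2) * (D e i j ^ 2 * g e ^ 2) := by
      nth_rewrite 2 [← h1]
      nth_rewrite 2 [← Finset.mul_sum]
      rw [← h2, Finset.mul_sum, ← Finset.sum_add_distrib, ← Finset.sum_add_distrib]
      apply Finset.sum_le_sum
      intro e _
      nlinarith [sq_nonneg (D e i j * D e i j)]
    rw [← Finset.mul_sum] at h3
    linarith
  have hmain : 2 * n * ∑ e, g e ^ 4 ≤ n * ∑ e, g e ^ 4 + (9 * n / 16) * ∑ i, ∑ j, ∑ e, D e i j ^ 4 := by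
    have e1 : 2 * n * ∑ e, g e ^ 4 = ∑ i, ∑ j, ∑ e, D e i j * g e ^ 3 := by
      calc 2 * n * ∑ e, g e ^ 4 = ∑ e, (∑ i, ∑ j, D e i j) * g e ^ 3 := by
            rw [Finset.mul_sum]; refine Finset.sum_congr rfl fun e _ => ?_
            rw [hsumD]; ring
        _ = ∑ e, ∑ i, ∑ j, D e i j * g e ^ 3 := by simp only [Finset.sum_mul]
        _ = _ := by
            rw [Finset.sum_comm]; refine Finset.sum_congr rfl fun i _ => ?_
            rw [Finset.sum_comm]
    have e2 : ∀ i j, ∑ e, D e i j * g e ^ 3 ≤ (n:ℝ)⁻¹ * ∑ e, g e ^ 4 + (9 * n / 16) * ∑ e, D e i j ^ 4 := by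
      intro i j
      have : (3/2) * ∑ e, D e i j ^ 2 * g e ^ 2 ≤ (n:ℝ)⁻¹ * ∑ e, g e ^ 4 + (9 * n / 16) * ∑ e, D e i j ^ 4 := by
        rw [Finset.mul_sum, Finset.mul_sum, Finset.mul_sum, ← Finset.sum_add_distrib]
        apply Finset.sum_le_sum
        intro e _
        have : (n:ℝ)⁻¹ * g e ^ 4 + (9 * n / 16) * D e i j ^ 4 - (3/2) * (D e i j ^ 2 * g e ^ 2)
          = (n:ℝ)⁻¹ * (g e ^ 2 - 3 * n / 4 * D e i j ^ 2)^2 := by field_simp; ring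
        have : 0 ≤ (n:ℝ)⁻¹ * (g e ^ 2 - 3 * n / 4 * D e i j ^ 2)^2 := by positivity
        linarith
      linarith [hij i j]
    rw [e1]
    calc _ ≤ ∑ i : Fin n, ∑ j : Fin n, ((n:ℝ)⁻¹ * ∑ e, g e ^ 4 + (9 * n / 16) * ∑ e, D e i j ^ 4) :=
          Finset.sum_le_sum fun i _ => Finset.sum_le_sum fun j _ => e2 i j
      _ = _ := by
          simp only [Finset.sum_add_distrib, ← Finset.mul_sum, Finset.sum_const, Finset.card_univ,
            Fintype.card_fin, nsmul_eq_mul]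
          field_simp
  have hF : ∀ i, (n:ℝ) * ∑ e : Equiv.Perm (Fin n), b (e i) ^ 4 = n.factorial * ∑ t, b t ^ 4 := by
    intro i
    have h1 : ∀ j, ∑ e : Equiv.Perm (Fin n), b (e j) ^ 4 = ∑ e : Equiv.Perm (Fin n), b (e i) ^ 4 := by
      intro j
      rw [← hre i j]; simp
    calc (n:ℝ) * ∑ e : Equiv.Perm (Fin n), b (e i) ^ 4
        = ∑ j : Fin n, ∑ e : Equiv.Perm (Fin n), b (e j) ^ 4 := by simp [h1]
      _ = ∑ e : Equiv.Perm (Fin n), ∑ t, b t ^ 4 := by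
          rw [Finset.sum_comm]
          exact Finset.sum_congr rfl fun e _ => Equiv.sum_comp e (fun t => b t ^ 4)
      _ = _ := by simp [Fintype.card_perm]
  have h8 : ∀ x y : ℝ, (x - y)^4 ≤ 8 * (x^4 + y^4) := by
    intro x y
    nlinarith [sq_nonneg (x^2-y^2), sq_nonneg (x+y), sq_nonneg ((x+y)^2), sq_nonneg (x*y), sq_nonneg (x^2+y^2+2*x*y), mul_nonneg (sq_nonneg (x+y)) (add_nonneg (sq_nonneg x) (sq_nonneg y)), mul_nonneg (sq_nonneg (x+y)) (sq_nonneg (x-y))]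
  have hD4 : ∀ i j, ∑ e, D e i j ^ 4 ≤ 64 * (a i ^ 4 + a j ^ 4) * (2 * ((n:ℝ)⁻¹ * (n.factorial * ∑ t, b t ^ 4))) := by
    intro i j
    have hi : ∀ i, ∑ e : Equiv.Perm (Fin n), b (e i) ^ 4 = (n:ℝ)⁻¹ * (n.factorial * ∑ t, b t ^ 4) := by
      intro i; rw [← hF i]; field_simp
    calc _ ≤ ∑ e : Equiv.Perm (Fin n), 64 * (a i ^ 4 + a j ^ 4) * (b (e i) ^ 4 + b (e j) ^ 4) := by
          apply Finset.sum_le_sum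
          intro e _
          simp only [hD, mul_pow]
          calc _ ≤ (8 * (a i ^ 4 + a j ^ 4)) * (8 * (b (e i) ^ 4 + b (e j) ^ 4)) := by
                apply mul_le_mul (h8 _ _) (h8 _ _) (by positivity) (by positivity)
            _ = _ := by ring
      _ = _ := by
          rw [← Finset.mul_sum, Finset.sum_add_distrib, hi, hi]; ring
  have hfin : ∑ i, ∑ j, ∑ e, D e i j ^ 4 ≤ 256 * (n.factorial * ((∑ t, a t ^ 4) * ∑ t, b t ^ 4)) := by
    calc _ ≤ ∑ i, ∑ j, 64 * (a i ^ 4 + a j ^ 4) * (2 * ((n:ℝ)⁻¹ * (n.factorial * ∑ t, b t ^ 4))) :=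
          Finset.sum_le_sum fun i _ => Finset.sum_le_sum fun j _ => hD4 i j
      _ = _ := by
          simp only [← Finset.sum_mul, ← Finset.mul_sum, Finset.sum_add_distrib, Finset.sum_const,
            Finset.card_univ, Fintype.card_fin, nsmul_eq_mul]
          field_simp
          ring
  have : ∑ e, g e ^ 4 ≤ (9/16) * ∑ i, ∑ j, ∑ e, D e i j ^ 4 := by
    have : n * ∑ e, g e ^ 4 ≤ n * ((9/16) * ∑ i, ∑ j, ∑ e, D e i j ^ 4) := by linarith
    exact le_of_mul_le_mul_left this hn'
  linarith


theorem ae_tendsto_aux {Ω : Type*} [MeasurableSpace Ω] (μ : Measure Ω)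
    (f : ℕ → Ω → ℝ) (hf : ∀ k, Measurable (f k)) (hf0 : ∀ k ω, 0 ≤ f k ω) (C : ℝ)
    (g : ℕ → Ω → ℝ) (hfg : ∀ k ω, f k ω ≤ g k ω) (hg : ∀ k, Integrable (g k) μ)
    (hgC : ∀ k, ∫ ω, g k ω ∂μ ≤ C * (1 / (k:ℝ) ^ 2)) :
    ∀ᵐ ω ∂μ, Tendsto (fun k => f k ω) atTop (𝓝 0) := by
  have hm : ∀ k, Measurable fun ω => ENNReal.ofReal (f k ω) := fun k => (hf k).ennreal_ofReal
  have h1 : ∫⁻ ω, ∑' k, ENNReal.ofReal (f k ω) ∂μ ≠ ⊤ := by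
    rw [lintegral_tsum fun k => (hm k).aemeasurable]
    have hs : Summable fun k : ℕ => C * (1 / (k:ℝ) ^ 2) :=
      (Real.summable_one_div_nat_pow.mpr one_lt_two).mul_left C
    refine ne_top_of_le_ne_top hs.tsum_ofReal_ne_top (ENNReal.tsum_le_tsum fun k => ?_)
    calc ∫⁻ ω, ENNReal.ofReal (f k ω) ∂μ ≤ ∫⁻ ω, ENNReal.ofReal (g k ω) ∂μ :=
          lintegral_mono fun ω => ENNReal.ofReal_le_ofReal (hfg k ω)
      _ = ENNReal.ofReal (∫ ω, g k ω ∂μ) :=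
          (ofReal_integral_eq_lintegral_ofReal (hg k)
            (Eventually.of_forall fun ω => (hf0 k ω).trans (hfg k ω))).symm
      _ ≤ _ := ENNReal.ofReal_le_ofReal (hgC k)
  filter_upwards [ae_lt_top (Measurable.tsum hm) h1] with ω hω
  have h2 := ENNReal.tendsto_atTop_zero_of_tsum_ne_top hω.ne
  have h3 := (ENNReal.tendsto_toReal ENNReal.zero_ne_top).comp h2
  simpa [Function.comp_def, ENNReal.toReal_ofReal, hf0] using h3

theorem second_moment_aux {Ω : Type*} [MeasurableSpace Ω] (μ : Measure Ω)
    (ℓ : ℕ) (Y : ℕ → Ω → ℝ) (hY2 : ∀ t, MemLp (Y t) 2 μ) (C : ℝ)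
    (hC : ∀ t, ∫ ω, Y t ω ^ 2 ∂μ ≤ C)
    (hfar : ∀ i j : ℕ, ℓ ≤ ((i : ℤ) - (j : ℤ)).natAbs → ∫ ω, Y i ω * Y j ω ∂μ = 0) (n : ℕ) :
    Integrable (fun ω => (∑ t ∈ Finset.range n, Y t ω) ^ 2) μ ∧
    ∫ ω, (∑ t ∈ Finset.range n, Y t ω) ^ 2 ∂μ ≤ 2 * ℓ * C * n := by
  have hC0 : 0 ≤ C := (integral_nonneg fun ω => sq_nonneg _).trans (hC 0)
  have hI : ∀ i j, Integrable (fun ω => Y i ω * Y j ω) μ := fun i j => (hY2 i).integrable_mul (hY2 j)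
  have he : (fun ω => (∑ t ∈ Finset.range n, Y t ω) ^ 2) =
      fun ω => ∑ i ∈ Finset.range n, ∑ j ∈ Finset.range n, Y i ω * Y j ω := by
    funext ω; rw [sq, Finset.sum_mul_sum]
  rw [he]
  refine ⟨integrable_finsetSum _ fun i _ => integrable_finsetSum _ fun j _ => hI i j, ?_⟩
  rw [integral_finsetSum _ fun i _ => integrable_finsetSum _ fun j _ => hI i j]
  have hbd : ∀ i j, ∫ ω, Y i ω * Y j ω ∂μ ≤ C := by
    intro i j
    have h2 : ∀ i, Integrable (fun ω => Y i ω ^ 2) μ := fun i => (hY2 i).integrable_sq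
    calc ∫ ω, Y i ω * Y j ω ∂μ ≤ ∫ ω, (1/2) * (Y i ω ^ 2 + Y j ω ^ 2) ∂μ := by
          apply integral_mono (hI i j) (((h2 i).add (h2 j)).const_mul _)
          intro ω
          simp only [Pi.add_apply]
          nlinarith [sq_nonneg (Y i ω - Y j ω)]
      _ = (1/2) * (∫ ω, Y i ω ^ 2 ∂μ + ∫ ω, Y j ω ^ 2 ∂μ) := by
          rw [integral_const_mul, integral_add (h2 i) (h2 j)]
      _ ≤ C := by linarith [hC i, hC j]
  have hrow : ∀ i, ∫ ω, ∑ j ∈ Finset.range n, Y i ω * Y j ω ∂μ ≤ 2 * ℓ * C := by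
    intro i
    rw [integral_finsetSum _ fun j _ => hI i j]
    calc ∑ j ∈ Finset.range n, ∫ ω, Y i ω * Y j ω ∂μ
        ≤ ∑ j ∈ Finset.range n, if ((i : ℤ) - (j : ℤ)).natAbs < ℓ then C else 0 := by
          apply Finset.sum_le_sum
          intro j _
          split_ifs with h
          · exact hbd i j
          · exact (hfar i j (not_lt.mp h)).le
      _ = ((Finset.range n).filter fun j : ℕ => ((i : ℤ) - (j : ℤ)).natAbs < ℓ).card * C := by
          rw [← Finset.sum_filter, Finset.sum_const, nsmul_eq_mul]
      _ ≤ 2 * ℓ * C := by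
          apply mul_le_mul_of_nonneg_right _ hC0
          have : ((Finset.range n).filter fun j : ℕ => ((i : ℤ) - (j : ℤ)).natAbs < ℓ) ⊆
              Finset.Ico (i + 1 - ℓ) (i + ℓ) := by
            intro j hj
            simp only [Finset.mem_filter, Finset.mem_Ico] at hj ⊢
            omega
          have := Finset.card_le_card this
          rw [Nat.card_Ico] at this
          have : ((Finset.range n).filter fun j : ℕ => ((i : ℤ) - (j : ℤ)).natAbs < ℓ).card ≤ 2 * ℓ := by
            omega
          exact_mod_cast this
  calc _ ≤ ∑ i ∈ Finset.range n, 2 * ℓ * C := Finset.sum_le_sum fun i _ => hrow i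
    _ = _ := by simp; ring

theorem slln_aux {Ω : Type*} [MeasurableSpace Ω] (μ : Measure Ω)
    (ℓ : ℕ) (Y : ℕ → Ω → ℝ) (hYm : ∀ t, Measurable (Y t)) (hY2 : ∀ t, MemLp (Y t) 2 μ) (C : ℝ)
    (hC : ∀ t, ∫ ω, Y t ω ^ 2 ∂μ ≤ C)
    (hfar : ∀ i j : ℕ, ℓ ≤ ((i : ℤ) - (j : ℤ)).natAbs → ∫ ω, Y i ω * Y j ω ∂μ = 0) :
    ∀ᵐ ω ∂μ, Tendsto (fun n : ℕ => (n:ℝ)⁻¹ * ∑ t ∈ Finset.range n, Y t ω) atTop (𝓝 0) := by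
  have hC0 : 0 ≤ C := (integral_nonneg fun ω => sq_nonneg _).trans (hC 0)
  have h2 : ∀ i, Integrable (fun ω => Y i ω ^ 2) μ := fun i => (hY2 i).integrable_sq
  set Z : ℕ → Ω → ℝ := fun k ω => (|∑ t ∈ Finset.range (k^2), Y t ω| +
    ∑ t ∈ Finset.Ico (k^2) ((k+1)^2), |Y t ω|) / (k:ℝ)^2 with hZ
  have hcard : ∀ k : ℕ, (Finset.Ico (k^2) ((k+1)^2)).card = 2 * k + 1 := by
    intro k
    rw [Nat.card_Ico]
    have : (k+1)^2 = k^2 + (2*k+1) := by ring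
    omega
  have hZ2 : ∀ᵐ ω ∂μ, Tendsto (fun k => Z k ω ^ 2) atTop (𝓝 0) := by
    refine ae_tendsto_aux μ (fun k ω => Z k ω ^ 2) ?_ (fun k ω => sq_nonneg _) (2 * (2 * ℓ + 9) * C)
      (fun k ω => (2 / (k:ℝ)^4) * ((∑ t ∈ Finset.range (k^2), Y t ω)^2 +
        (2 * k + 1) * ∑ t ∈ Finset.Ico (k^2) ((k+1)^2), Y t ω ^ 2)) ?_ ?_ ?_
    · intro k
      simp only [hZ]
      fun_prop
    · intro k ω
      simp only [hZ]
      have h1 := sq_sum_le_card_mul_sum_sq (s := Finset.Ico (k^2) ((k+1)^2)) (f := fun t => |Y t ω|)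
      rw [hcard] at h1
      simp only [sq_abs] at h1
      push_cast at h1
      rw [div_pow, ← pow_mul, div_eq_inv_mul, div_eq_inv_mul, mul_assoc]
      apply mul_le_mul_of_nonneg_left _ (by positivity)
      have h3 := sq_abs (∑ t ∈ Finset.range (k^2), Y t ω)
      nlinarith [sq_nonneg (|∑ t ∈ Finset.range (k^2), Y t ω| -
        ∑ t ∈ Finset.Ico (k^2) ((k+1)^2), |Y t ω|)]
    · intro k
      exact (((second_moment_aux μ ℓ Y hY2 C hC hfar _).1).add
        ((integrable_finsetSum _ fun i _ => h2 i).const_mul _)).const_mul _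
    · intro k
      rw [integral_const_mul, integral_add (second_moment_aux μ ℓ Y hY2 C hC hfar _).1
        ((integrable_finsetSum _ fun i _ => h2 i).const_mul _), integral_const_mul,
        integral_finsetSum _ fun i _ => h2 i]
      have hA := (second_moment_aux μ ℓ Y hY2 C hC hfar (k^2)).2
      have hB : ∑ i ∈ Finset.Ico (k^2) ((k+1)^2), ∫ ω, Y i ω ^ 2 ∂μ ≤ (2 * k + 1) * C := by
        calc _ ≤ ∑ i ∈ Finset.Ico (k^2) ((k+1)^2), C := Finset.sum_le_sum fun i _ => hC i
          _ = _ := by rw [Finset.sum_const, hcard, nsmul_eq_mul]; push_cast; ring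
      rcases Nat.eq_zero_or_pos k with hk | hk
      · subst hk; simp
      have hk1 : (1:ℝ) ≤ k := by exact_mod_cast hk
      push_cast at hA
      calc _ ≤ (2 / (k:ℝ)^4) * (2 * ℓ * C * k^2 + (2*k+1) * ((2*k+1) * C)) := by gcongr
        _ ≤ (2 / (k:ℝ)^4) * (2 * ℓ * C * k^2 + 9 * k^2 * C) := by
            have hh : (2*(k:ℝ)+1) * ((2*k+1) * C) ≤ 9 * (k:ℝ)^2 * C := by
              rw [← mul_assoc]
              exact mul_le_mul_of_nonneg_right (by nlinarith) hC0
            exact mul_le_mul_of_nonneg_left (by linarith) (by positivity)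
        _ = _ := by field_simp
  filter_upwards [hZ2] with ω hω
  have hZ1 : Tendsto (fun k => Z k ω) atTop (𝓝 0) := by
    have h := (Real.continuous_sqrt.tendsto 0).comp hω
    simp only [Real.sqrt_zero] at h
    refine h.congr fun k => ?_
    simp only [Function.comp]
    exact Real.sqrt_sq (by simp only [hZ]; positivity)
  have hsq : Tendsto Nat.sqrt atTop atTop := by
    refine tendsto_atTop.mpr fun b => ?_
    filter_upwards [eventually_ge_atTop (b*b)] with n hn
    exact Nat.le_sqrt.mpr hn
  refine squeeze_zero_norm' ?_ (hZ1.comp hsq)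
  filter_upwards [eventually_ge_atTop 1] with n hn
  simp only [Function.comp, hZ, Real.norm_eq_abs, abs_mul, abs_inv, Nat.abs_cast]
  set k := n.sqrt with hk
  have hk1 : 1 ≤ k := Nat.le_sqrt.mpr (by omega)
  have hkn : k^2 ≤ n := Nat.sqrt_le' n
  have hnk : n < (k+1)^2 := Nat.lt_succ_sqrt' n
  have hS : |∑ t ∈ Finset.range n, Y t ω| ≤ |∑ t ∈ Finset.range (k^2), Y t ω| +
    ∑ t ∈ Finset.Ico (k^2) ((k+1)^2), |Y t ω| := by
    rw [← Finset.sum_range_add_sum_Ico _ hkn]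
    refine (abs_add_le _ _).trans ?_
    gcongr
    refine (Finset.abs_sum_le_sum_abs _ _).trans ?_
    apply Finset.sum_le_sum_of_subset_of_nonneg
    · exact Finset.Ico_subset_Ico_right hnk.le
    · intros; positivity
  rw [div_eq_inv_mul]
  have hk2 : (0:ℝ) < (k:ℝ)^2 := by positivity
  have : ((k:ℝ)^2) ≤ n := by exact_mod_cast hkn
  gcongr

theorem cesaro_aux (c : ℕ → ℝ) (N : ℕ) (hc : ∀ j, N ≤ j → c j = 0) :
    Tendsto (fun n : ℕ => (n:ℝ)⁻¹ * ∑ t ∈ Finset.range n, c t) atTop (𝓝 0) := by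
  have h : Tendsto (fun n : ℕ => (n:ℝ)⁻¹ * ∑ t ∈ Finset.range N, c t) atTop (𝓝 0) := by
    simpa using (tendsto_inv_atTop_nhds_zero_nat (𝕜 := ℝ)).mul_const (∑ t ∈ Finset.range N, c t)
  refine h.congr' ?_
  filter_upwards [eventually_ge_atTop N] with n hn
  congr 1
  apply Finset.sum_subset (Finset.range_subset_range.mpr hn)
  intro x _ hx
  exact hc x (by simpa using hx)

theorem prod_aux (x y β : ℕ → ℝ) (M : ℝ) (hx : Tendsto x atTop (𝓝 0))
    (hy : Tendsto (fun n => y n - β n) atTop (𝓝 0)) (hβ : ∀ n, |β n| ≤ M) :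
    Tendsto (fun n => x n * y n) atTop (𝓝 0) := by
  have h1 : Tendsto (fun n => x n * (y n - β n)) atTop (𝓝 0) := by simpa using hx.mul hy
  have h2 : Tendsto (fun n => x n * β n) atTop (𝓝 0) := by
    have h3 : Tendsto (fun n => |x n| * M) atTop (𝓝 0) := by simpa using hx.abs.mul_const M
    refine squeeze_zero_norm (fun n => ?_) h3
    rw [Real.norm_eq_abs, abs_mul]
    exact mul_le_mul_of_nonneg_left (hβ n) (abs_nonneg _)
  have h4 := h1.add h2
  rw [add_zero] at h4
  exact h4.congr fun n => by ring

theorem mean_aux {Ω : Type*} [MeasurableSpace Ω] (μ : Measure Ω) [IsProbabilityMeasure μ]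
    (ℓ : ℕ) (κ : ℝ) (a : ℕ → Ω → ℝ) (ham : ∀ t, Measurable (a t))
    (ha4 : ∀ t, Integrable (fun ω => a t ω ^ 4) μ ∧ ∫ ω, a t ω ^ 4 ∂μ ≤ κ)
    (hfar : ∀ i j : ℕ, ℓ ≤ ((i : ℤ) - (j : ℤ)).natAbs → IndepFun (a i) (a j) μ) :
    (∀ᵐ ω ∂μ, Tendsto (fun n : ℕ => (n:ℝ)⁻¹ * ∑ t ∈ Finset.range n, a t ω -
      (n:ℝ)⁻¹ * ∑ t ∈ Finset.range n, ∫ ω, a t ω ∂μ) atTop (𝓝 0)) ∧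
    ∀ n : ℕ, |(n:ℝ)⁻¹ * ∑ t ∈ Finset.range n, ∫ ω, a t ω ∂μ| ≤ 2 + κ := by
  have hsq : ∀ t, Integrable (fun ω => a t ω ^ 2) μ ∧ ∫ ω, a t ω ^ 2 ∂μ ≤ 1 + κ := by
    intro t
    have hI : Integrable (fun ω => 1 + a t ω ^ 4) μ := (integrable_const 1).add (ha4 t).1
    have hle : ∀ ω, a t ω ^ 2 ≤ 1 + a t ω ^ 4 := fun ω => by nlinarith [sq_nonneg (a t ω ^ 2 - 1)]
    have h1 : Integrable (fun ω => a t ω ^ 2) μ := by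
      refine hI.mono' ((ham t).pow_const 2).aestronglyMeasurable (Eventually.of_forall fun ω => ?_)
      rw [Real.norm_eq_abs, abs_of_nonneg (sq_nonneg _)]
      exact hle ω
    refine ⟨h1, (integral_mono h1 hI hle).trans ?_⟩
    rw [integral_add (integrable_const 1) (ha4 t).1]
    simpa using (ha4 t).2
  have hL : ∀ t, MemLp (a t) 2 μ := fun t =>
    (memLp_two_iff_integrable_sq (ham t).aestronglyMeasurable).mpr (hsq t).1
  have hI1 : ∀ t, Integrable (a t) μ := fun t => (hL t).integrable one_le_two
  constructor
  · have := slln_aux μ ℓ (fun t ω => a t ω - ∫ ω, a t ω ∂μ) (fun t => (ham t).sub_const _)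
      (fun t => (hL t).sub (memLp_const _)) (1 + κ) ?_ ?_
    · filter_upwards [this] with ω hω
      refine hω.congr fun n => ?_
      rw [Finset.sum_sub_distrib, mul_sub]
    · intro t
      have h := variance_le_expectation_sq (μ := μ) (X := a t) (ham t).aestronglyMeasurable
      rw [variance_eq_integral (ham t).aemeasurable] at h
      exact h.trans (by simpa using (hsq t).2)
    · intro i j hij
      have hind : IndepFun (fun ω => a i ω - ∫ ω, a i ω ∂μ) (fun ω => a j ω - ∫ ω, a j ω ∂μ) μ :=
        (hfar i j hij).comp (φ := fun x => x - ∫ ω, a i ω ∂μ) (ψ := fun x => x - ∫ ω, a j ω ∂μ)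
          (by fun_prop) (by fun_prop)
      rw [hind.integral_fun_mul_eq_mul_integral ((ham i).sub_const _).aestronglyMeasurable
        ((ham j).sub_const _).aestronglyMeasurable, integral_sub (hI1 i) (integrable_const _)]
      simp
  · intro n
    have hκ : 0 ≤ κ := (integral_nonneg fun ω => by positivity).trans (ha4 0).2
    have hE : ∀ t, |∫ ω, a t ω ∂μ| ≤ 2 + κ := by
      intro t
      have hI : Integrable (fun ω => 1 + a t ω ^ 2) μ := (integrable_const 1).add (hsq t).1
      refine abs_integral_le_integral_abs.trans ((integral_mono (hI1 t).abs hI fun ω => ?_).trans ?_)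
      · simp only
        nlinarith [sq_nonneg (|a t ω| - 1), sq_abs (a t ω), abs_nonneg (a t ω)]
      · rw [integral_add (integrable_const 1) (hsq t).1]
        simp
        linarith [(hsq t).2]
    rw [abs_mul, abs_inv, Nat.abs_cast]
    rcases Nat.eq_zero_or_pos n with hn | hn
    · subst hn; simp; linarith
    have hn' : (0:ℝ) < n := by exact_mod_cast hn
    rw [inv_mul_le_iff₀ hn']
    calc _ ≤ ∑ t ∈ Finset.range n, |∫ ω, a t ω ∂μ| := Finset.abs_sum_le_sum_abs _ _
      _ ≤ ∑ t ∈ Finset.range n, (2 + κ) := Finset.sum_le_sum fun t _ => hE t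
      _ = _ := by rw [Finset.sum_const, Finset.card_range, nsmul_eq_mul]

theorem perm_part {Ω : Type*} (m : MeasurableSpace Ω) [mΩ : MeasurableSpace Ω] (μ : Measure Ω) [IsProbabilityMeasure μ]
    (K : ℝ) (a b : ℕ → Ω → ℝ)
    (ham : ∀ t, Measurable (a t)) (hbm : ∀ t, Measurable (b t))
    (ham' : ∀ t, Measurable[m] (a t)) (hbm' : ∀ t, Measurable[m] (b t))
    (hab : ∀ i j, Integrable (fun ω => a i ω ^ 4 * b j ω ^ 4) μ ∧
      ∫ ω, a i ω ^ 4 * b j ω ^ 4 ∂μ ≤ K)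
    (σ : (n : ℕ) → Ω → Equiv.Perm (Fin n))
    (hσunif : ∀ n, ∀ e : Equiv.Perm (Fin n), μ {ω | σ n ω = e} = (Nat.factorial n : ℝ≥0∞)⁻¹)
    (hσdata : Indep (⨆ n, MeasurableSpace.comap (σ n) ⊤) m μ) :
    ∀ᵐ ω ∂μ, Tendsto (fun n : ℕ => (n:ℝ)⁻¹ * (∑ t : Fin n, a t ω * b (σ n ω t) ω -
      (n:ℝ)⁻¹ * ((∑ t : Fin n, a t ω) * ∑ t : Fin n, b t ω))) atTop (𝓝 0) := by
  set G : (n : ℕ) → Equiv.Perm (Fin n) → Ω → ℝ := fun n e ω => ∑ t : Fin n, a t ω * b (e t) ω -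
      (n:ℝ)⁻¹ * ((∑ t : Fin n, a t ω) * ∑ t : Fin n, b t ω) with hG
  have hGm : ∀ n e, Measurable (G n e) := by
    intro n e; simp only [hG]; fun_prop
  have hGm' : ∀ n e, Measurable[m] (G n e) := by
    intro n e; simp only [hG]
    refine Measurable.sub (Finset.measurable_sum _ fun t _ => (ham' _).mul (hbm' _)) ?_
    exact Measurable.const_mul ((Finset.measurable_sum _ fun t _ => ham' _).mul
      (Finset.measurable_sum _ fun t _ => hbm' _)) _
  have hmom : ∀ n, 0 < n → (Nat.factorial n : ℝ≥0∞)⁻¹ * ∑ e, ∫⁻ ω, ENNReal.ofReal (G n e ω ^ 4) ∂μ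
      ≤ ENNReal.ofReal (144 * K * n ^ 2) := by
    intro n hn
    have hI : Integrable (fun ω => 144 * (n.factorial : ℝ) *
        ∑ i : Fin n, ∑ j : Fin n, a i ω ^ 4 * b j ω ^ 4) μ :=
      Integrable.const_mul (integrable_finsetSum Finset.univ fun i _ =>
        integrable_finsetSum Finset.univ fun j _ => (hab (i : Fin n) (j : Fin n)).1) _
    have h1 : ∑ e, ∫⁻ ω, ENNReal.ofReal (G n e ω ^ 4) ∂μ ≤
        ENNReal.ofReal (n.factorial * (144 * K * n ^ 2)) := by
      rw [← lintegral_finsetSum _ fun e _ => ((hGm n e).pow_const 4).ennreal_ofReal]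
      calc _ ≤ ∫⁻ ω, ENNReal.ofReal (144 * (n.factorial : ℝ) *
            ∑ i : Fin n, ∑ j : Fin n, a i ω ^ 4 * b j ω ^ 4) ∂μ := by
            apply lintegral_mono
            intro ω
            simp only
            rw [← ENNReal.ofReal_sum_of_nonneg fun e _ => by positivity]
            apply ENNReal.ofReal_le_ofReal
            rw [← Finset.sum_mul_sum]
            exact perm_fourth n hn (fun t => a t ω) (fun t => b t ω)
        _ = ENNReal.ofReal (∫ ω, 144 * (n.factorial : ℝ) *
            ∑ i : Fin n, ∑ j : Fin n, a i ω ^ 4 * b j ω ^ 4 ∂μ) := by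
            rw [ofReal_integral_eq_lintegral_ofReal hI]
            exact Eventually.of_forall fun ω => by
              simp only [Pi.zero_apply]; positivity
        _ ≤ _ := by
            apply ENNReal.ofReal_le_ofReal
            rw [integral_const_mul, integral_finsetSum Finset.univ fun i _ =>
              integrable_finsetSum Finset.univ fun j _ => (hab (i : Fin n) (j : Fin n)).1]
            have : ∑ i : Fin n, ∫ ω, ∑ j : Fin n, a i ω ^ 4 * b j ω ^ 4 ∂μ ≤ K * n ^ 2 := by
              calc _ ≤ ∑ i : Fin n, (n : ℝ) * K := by
                    apply Finset.sum_le_sum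
                    intro i _
                    rw [integral_finsetSum Finset.univ fun j _ => (hab i (j : Fin n)).1]
                    calc _ ≤ ∑ j : Fin n, K := Finset.sum_le_sum fun j _ => (hab i j).2
                      _ = _ := by simp
                _ = _ := by simp; ring
            calc _ ≤ 144 * (n.factorial : ℝ) * (K * n ^ 2) := by gcongr
              _ = _ := by ring
    calc _ ≤ (Nat.factorial n : ℝ≥0∞)⁻¹ * ENNReal.ofReal (n.factorial * (144 * K * n ^ 2)) := by gcongr
      _ = _ := by
        rw [ENNReal.ofReal_mul (by positivity), ENNReal.ofReal_natCast, ← mul_assoc,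
          ENNReal.inv_mul_cancel (by exact_mod_cast n.factorial_ne_zero) (ENNReal.natCast_ne_top _),
          one_mul]
  have hbc : ∀ c : ℝ, 0 < c → ∀ᵐ ω ∂μ, ∀ᶠ n in atTop,
      ω ∉ {ω | 0 < n ∧ (c * n) ^ 4 ≤ G n (σ n ω) ω ^ 4} := by
    intro c hc
    apply ae_eventually_notMem
    have hs : Summable fun k : ℕ => (144 * K / c ^ 4) * (1 / (k:ℝ) ^ 2) :=
      (Real.summable_one_div_nat_pow.mpr one_lt_two).mul_left _
    refine ne_top_of_le_ne_top hs.tsum_ofReal_ne_top (ENNReal.tsum_le_tsum fun n => ?_)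
    rcases Nat.eq_zero_or_pos n with hn | hn
    · subst hn; simp
    have hn' : (0:ℝ) < n := by exact_mod_cast hn
    have hT : 0 < (c * n) ^ 4 := by positivity
    have hsub : {ω | 0 < n ∧ (c * n) ^ 4 ≤ G n (σ n ω) ω ^ 4} ⊆
        ⋃ e ∈ (Finset.univ : Finset (Equiv.Perm (Fin n))),
          ({ω | σ n ω = e} ∩ {ω | (c * n) ^ 4 ≤ G n e ω ^ 4}) := by
      intro ω hω
      simp only [Set.mem_iUnion]
      exact ⟨σ n ω, Finset.mem_univ _, rfl, hω.2⟩
    have hind : ∀ e, μ ({ω | σ n ω = e} ∩ {ω | (c * n) ^ 4 ≤ G n e ω ^ 4}) =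
        (Nat.factorial n : ℝ≥0∞)⁻¹ * μ {ω | (c * n) ^ 4 ≤ G n e ω ^ 4} := by
      intro e
      rw [← hσunif n e]
      refine (Indep_iff _ _ _).mp hσdata _ _ ?_ ?_
      · exact le_iSup (fun n => MeasurableSpace.comap (σ n) ⊤) n _ ⟨{e}, trivial, rfl⟩
      · exact ((hGm' n e).pow_const 4) (measurableSet_Ici (a := (c * (n:ℝ)) ^ 4))
    have hmk : ∀ e, μ {ω | (c * n) ^ 4 ≤ G n e ω ^ 4} ≤
        (∫⁻ ω, ENNReal.ofReal (G n e ω ^ 4) ∂μ) / ENNReal.ofReal ((c * n) ^ 4) := by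
      intro e
      refine le_trans (measure_mono (μ := μ) fun ω hω => ?_)
        (meas_ge_le_lintegral_div (μ := μ) ((hGm n e).pow_const 4).ennreal_ofReal.aemeasurable
          (by simpa using hT) ENNReal.ofReal_ne_top)
      exact ENNReal.ofReal_le_ofReal hω
    calc _ ≤ ∑ e, μ ({ω | σ n ω = e} ∩ {ω | (c * n) ^ 4 ≤ G n e ω ^ 4}) :=
          (measure_mono hsub).trans (measure_biUnion_finset_le _ _)
      _ ≤ ∑ e, (Nat.factorial n : ℝ≥0∞)⁻¹ *
          ((∫⁻ ω, ENNReal.ofReal (G n e ω ^ 4) ∂μ) / ENNReal.ofReal ((c * n) ^ 4)) := by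
          apply Finset.sum_le_sum
          intro e _
          rw [hind e]
          gcongr
          exact hmk e
      _ = ((Nat.factorial n : ℝ≥0∞)⁻¹ * ∑ e, ∫⁻ ω, ENNReal.ofReal (G n e ω ^ 4) ∂μ) /
          ENNReal.ofReal ((c * n) ^ 4) := by
          simp only [div_eq_mul_inv]
          rw [Finset.mul_sum, Finset.sum_mul]
          exact Finset.sum_congr rfl fun e _ => (mul_assoc _ _ _).symm
      _ ≤ ENNReal.ofReal (144 * K * n ^ 2) / ENNReal.ofReal ((c * n) ^ 4) := by
          gcongr
          exact hmom n hn
      _ = _ := by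
          rw [← ENNReal.ofReal_div_of_pos hT]
          congr 1
          field_simp
  have hall : ∀ᵐ ω ∂μ, ∀ q : ℕ, ∀ᶠ n in atTop,
      ω ∉ {ω | 0 < n ∧ ((1 / ((q:ℝ) + 1)) * n) ^ 4 ≤ G n (σ n ω) ω ^ 4} :=
    ae_all_iff.mpr fun q => hbc _ (by positivity)
  filter_upwards [hall] with ω hω
  rw [Metric.tendsto_atTop']
  intro ε hε
  obtain ⟨q, hq⟩ := exists_nat_one_div_lt hε
  obtain ⟨N, hN⟩ := eventually_atTop.mp (hω q)
  refine ⟨N, fun n hn => ?_⟩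
  have h := hN n hn.le
  have hn0 : 0 < n := by omega
  have hn' : (0:ℝ) < n := by exact_mod_cast hn0
  simp only [not_and, not_le] at h
  have h := h hn0
  rw [Real.dist_eq, sub_zero, abs_mul, abs_inv, Nat.abs_cast, inv_mul_lt_iff₀ hn']
  have h4 : |G n (σ n ω) ω| ^ 4 < ((1 / ((q:ℝ) + 1)) * n) ^ 4 := by
    rwa [Even.pow_abs (by decide)]
  have h5 := lt_of_pow_lt_pow_left₀ 4 (by positivity) h4
  calc _ < (1 / ((q:ℝ) + 1)) * n := h5
    _ ≤ _ := by rw [mul_comm]; gcongr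

theorem scalar_main {Ω : Type*} (m : MeasurableSpace Ω) [mΩ : MeasurableSpace Ω] (μ : Measure Ω) [IsProbabilityMeasure μ]
    (ℓ : ℕ) (κ : ℝ) (a b : ℕ → Ω → ℝ)
    (ham : ∀ t, Measurable (a t)) (hbm : ∀ t, Measurable (b t))
    (ham' : ∀ t, Measurable[m] (a t)) (hbm' : ∀ t, Measurable[m] (b t))
    (ha4 : ∀ t, Integrable (fun ω => a t ω ^ 4) μ ∧ ∫ ω, a t ω ^ 4 ∂μ ≤ κ)
    (hb4 : ∀ t, Integrable (fun ω => b t ω ^ 4) μ ∧ ∫ ω, b t ω ^ 4 ∂μ ≤ κ)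
    (hafar : ∀ i j : ℕ, ℓ ≤ ((i : ℤ) - (j : ℤ)).natAbs → IndepFun (a i) (a j) μ)
    (hbfar : ∀ i j : ℕ, ℓ ≤ ((i : ℤ) - (j : ℤ)).natAbs → IndepFun (b i) (b j) μ)
    (habfar : ∀ i j : ℕ, ℓ ≤ ((i : ℤ) - (j : ℤ)).natAbs → IndepFun (a i) (b j) μ)
    (hzero : ∀ i j : ℕ, ℓ ≤ ((i : ℤ) - (j : ℤ)).natAbs → ∫ ω, a i ω * b j ω ∂μ = 0)
    (hnear : ∀ i j : ℕ, ((i : ℤ) - (j : ℤ)).natAbs < ℓ →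
      Integrable (fun ω => a i ω ^ 4 * b j ω ^ 4) μ ∧ ∫ ω, a i ω ^ 4 * b j ω ^ 4 ∂μ ≤ κ)
    (σ : (n : ℕ) → Ω → Equiv.Perm (Fin n))
    (hσunif : ∀ n, ∀ e : Equiv.Perm (Fin n), μ {ω | σ n ω = e} = (Nat.factorial n : ℝ≥0∞)⁻¹)
    (hσdata : Indep (⨆ n, MeasurableSpace.comap (σ n) ⊤) m μ) :
    ∀ᵐ ω ∂μ, Tendsto (fun n : ℕ => (n:ℝ)⁻¹ * ∑ t : Fin n, a t ω * b (σ n ω t) ω)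
      atTop (𝓝 0) := by
  have hκ : 0 ≤ κ := (integral_nonneg fun ω => by positivity).trans (ha4 0).2
  have hab : ∀ i j, Integrable (fun ω => a i ω ^ 4 * b j ω ^ 4) μ ∧
      ∫ ω, a i ω ^ 4 * b j ω ^ 4 ∂μ ≤ κ + κ * κ := by
    intro i j
    rcases lt_or_ge ((i : ℤ) - (j : ℤ)).natAbs ℓ with h | h
    · exact ⟨(hnear i j h).1, (hnear i j h).2.trans (by nlinarith)⟩
    · have hind : IndepFun (fun ω => a i ω ^ 4) (fun ω => b j ω ^ 4) μ :=
        (habfar i j h).comp (φ := fun x : ℝ => x ^ 4) (ψ := fun x : ℝ => x ^ 4)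
          (by fun_prop) (by fun_prop)
      refine ⟨hind.integrable_mul (ha4 i).1 (hb4 j).1, ?_⟩
      rw [hind.integral_fun_mul_eq_mul_integral (ha4 i).1.aestronglyMeasurable
        (hb4 j).1.aestronglyMeasurable]
      have : (∫ ω, a i ω ^ 4 ∂μ) * ∫ ω, b j ω ^ 4 ∂μ ≤ κ * κ :=
        mul_le_mul (ha4 i).2 (hb4 j).2 (integral_nonneg fun ω => by positivity) hκ
      linarith
  have hP := perm_part m μ (κ + κ * κ) a b ham hbm ham' hbm' hab σ hσunif hσdata
  obtain ⟨hA, hAb⟩ := mean_aux μ ℓ κ a ham ha4 hafar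
  obtain ⟨hB, hBb⟩ := mean_aux μ ℓ κ b hbm hb4 hbfar
  have hprod : ∀ i j : ℕ, ℓ ≤ ((i : ℤ) - (j : ℤ)).natAbs →
      (∫ ω, a i ω ∂μ) * ∫ ω, b j ω ∂μ = 0 := by
    intro i j h
    rw [← (habfar i j h).integral_fun_mul_eq_mul_integral (ham i).aestronglyMeasurable
      (hbm j).aestronglyMeasurable]
    exact hzero i j h
  have hcase : (∀ j, 0 ≤ j → ∫ ω, a j ω ∂μ = 0) ∨ ∃ N, ∀ j, N ≤ j → ∫ ω, b j ω ∂μ = 0 := by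
    by_cases h : ∀ j, 0 ≤ j → ∫ ω, a j ω ∂μ = 0
    · exact Or.inl h
    · right
      push Not at h
      obtain ⟨i, _, hi⟩ := h
      refine ⟨i + ℓ, fun j hj => ?_⟩
      exact (mul_eq_zero.mp (hprod i j (by omega))).resolve_left hi
  filter_upwards [hP, hA, hB] with ω hPω hAω hBω
  have hm : Tendsto (fun n : ℕ => ((n:ℝ)⁻¹ * ∑ t ∈ Finset.range n, a t ω) *
      ((n:ℝ)⁻¹ * ∑ t ∈ Finset.range n, b t ω)) atTop (𝓝 0) := by
    rcases hcase with h | ⟨N, h⟩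
    · have hx := hAω.add (cesaro_aux _ 0 h)
      simp only [sub_add_cancel, add_zero] at hx
      exact prod_aux _ _ _ _ hx hBω hBb
    · have hx := hBω.add (cesaro_aux _ N h)
      simp only [sub_add_cancel, add_zero] at hx
      exact (prod_aux _ _ _ _ hx hAω hAb).congr fun n => mul_comm _ _
  have hf := hPω.add hm
  rw [add_zero] at hf
  refine hf.congr fun n => ?_
  rw [Finset.sum_range, Finset.sum_range]
  ring

/-- If `{φ_t}` and `{ψ_t}` are `ℓ`-independent `ℝ^d`-valued sequences with uniformly
bounded fourth moments, far cross-independent with zero far cross-correlation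
matrices, bounded near joint moments, and `σ_n` are uniform random permutations of
`{0,…,n-1}` independent of each other and of `{ψ_t}`, `{φ_t}`, then the matrix
`(1/n) ∑_{t<n} ψ_t φ_{σ_n(t)}ᵀ` converges to the zero matrix almost surely. -/
theorem permuted_outer_product_slln
    {Ω : Type*} [MeasurableSpace Ω] (μ : Measure Ω) [IsProbabilityMeasure μ]
    (d ℓ : ℕ) (κ : ℝ)
    (φ ψ : ℕ → Ω → EuclideanSpace ℝ (Fin d))
    (hφmeas : ∀ t, Measurable (φ t)) (hψmeas : ∀ t, Measurable (ψ t))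
    (hφLindep : LIndepSeq ℓ φ μ)
    (hφ4 : ∀ t, Integrable (fun ω => ‖φ t ω‖ ^ 4) μ ∧ ∫ ω, ‖φ t ω‖ ^ 4 ∂μ ≤ κ)
    (hψLindep : LIndepSeq ℓ ψ μ)
    (hψ4 : ∀ t, Integrable (fun ω => ‖ψ t ω‖ ^ 4) μ ∧ ∫ ω, ‖ψ t ω‖ ^ 4 ∂μ ≤ κ)
    (hfar_indep : ∀ i j : ℕ, ℓ ≤ ((i : ℤ) - (j : ℤ)).natAbs → IndepFun (ψ i) (φ j) μ)
    (hfar_zero : ∀ i j : ℕ, ℓ ≤ ((i : ℤ) - (j : ℤ)).natAbs →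
      ∀ k l : Fin d, ∫ ω, ψ i ω k * φ j ω l ∂μ = 0)
    (hnear : ∀ i j : ℕ, ((i : ℤ) - (j : ℤ)).natAbs < ℓ → ∀ k l : Fin d,
      Integrable (fun ω => ψ i ω k ^ 4 * φ j ω l ^ 4) μ ∧
        ∫ ω, ψ i ω k ^ 4 * φ j ω l ^ 4 ∂μ ≤ κ)
    (σ : (n : ℕ) → Ω → Equiv.Perm (Fin n))
    (hσunif : ∀ n, IsUniformPerm (σ n) μ)
    (hσindep : iIndep (fun n => MeasurableSpace.comap (σ n) ⊤) μ)
    (hσdata : Indep (⨆ n, MeasurableSpace.comap (σ n) ⊤)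
      ((⨆ t, MeasurableSpace.comap (ψ t) inferInstance) ⊔
        ⨆ t, MeasurableSpace.comap (φ t) inferInstance) μ) :
    ∀ᵐ ω ∂μ, Tendsto
      (fun n : ℕ => Matrix.of fun k l : Fin d =>
        (n : ℝ)⁻¹ * ∑ t : Fin n, ψ (t : ℕ) ω k * φ ((σ n ω t : Fin n) : ℕ) ω l)
      atTop (𝓝 (0 : Matrix (Fin d) (Fin d) ℝ)) := by
  have hent : ∀ k l : Fin d, ∀ᵐ ω ∂μ, Tendsto
      (fun n : ℕ => (n : ℝ)⁻¹ * ∑ t : Fin n, ψ (t : ℕ) ω k * φ ((σ n ω t : Fin n) : ℕ) ω l)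
      atTop (𝓝 0) := by
    intro k l
    have hev : ∀ k : Fin d, Measurable fun x : EuclideanSpace ℝ (Fin d) => x k := fun k => by
      fun_prop
    have h4 : ∀ (X : ℕ → Ω → EuclideanSpace ℝ (Fin d)) (_ : ∀ t, Measurable (X t))
        (_ : ∀ t, Integrable (fun ω => ‖X t ω‖ ^ 4) μ ∧ ∫ ω, ‖X t ω‖ ^ 4 ∂μ ≤ κ) (k : Fin d) (t : ℕ),
        Integrable (fun ω => X t ω k ^ 4) μ ∧ ∫ ω, X t ω k ^ 4 ∂μ ≤ κ := by
      intro X hXm hX k t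
      have hle : ∀ ω, X t ω k ^ 4 ≤ ‖X t ω‖ ^ 4 := by
        intro ω
        rw [← Even.pow_abs (by decide : Even 4) (X t ω k)]
        exact pow_le_pow_left₀ (abs_nonneg _) (PiLp.norm_apply_le (X t ω) k) 4
      have hI : Integrable (fun ω => X t ω k ^ 4) μ := by
        refine (hX t).1.mono' (((hev k).comp (hXm t)).pow_const 4).aestronglyMeasurable
          (Eventually.of_forall fun ω => ?_)
        rw [Real.norm_eq_abs, abs_of_nonneg (by positivity)]
        exact hle ω
      exact ⟨hI, (integral_mono hI (hX t).1 hle).trans (hX t).2⟩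
    have hfar : ∀ (X : ℕ → Ω → EuclideanSpace ℝ (Fin d)) (_ : LIndepSeq ℓ X μ) (k : Fin d)
        (i j : ℕ), ℓ ≤ ((i : ℤ) - (j : ℤ)).natAbs →
        IndepFun (fun ω => X i ω k) (fun ω => X j ω k) μ := by
      intro X hX k i j hij
      exact (hX i).comp (φ := fun x => x k)
        (ψ := fun f : {k : ℕ // ℓ ≤ ((i : ℤ) - (k : ℤ)).natAbs} → EuclideanSpace ℝ (Fin d) =>
          f ⟨j, hij⟩ k) (hev k) ((hev k).comp (measurable_pi_apply _))
    refine scalar_main ((⨆ t, MeasurableSpace.comap (ψ t) inferInstance) ⊔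
        ⨆ t, MeasurableSpace.comap (φ t) inferInstance) μ ℓ κ
      (fun t ω => ψ t ω k) (fun t ω => φ t ω l)
      (fun t => (hev k).comp (hψmeas t)) (fun t => (hev l).comp (hφmeas t)) ?_ ?_
      (h4 ψ hψmeas hψ4 k) (h4 φ hφmeas hφ4 l) (hfar ψ hψLindep k) (hfar φ hφLindep l)
      (fun i j hij => (hfar_indep i j hij).comp (hev k) (hev l))
      (fun i j hij => hfar_zero i j hij k l) (fun i j hij => hnear i j hij k l)
      σ hσunif hσdata
    · intro t
      refine (hev k).comp (Measurable.mono (comap_measurable (ψ t)) ?_ le_rfl)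
      exact le_trans (le_iSup (fun t => MeasurableSpace.comap (ψ t) inferInstance) t) le_sup_left
    · intro t
      refine (hev l).comp (Measurable.mono (comap_measurable (φ t)) ?_ le_rfl)
      exact le_trans (le_iSup (fun t => MeasurableSpace.comap (φ t) inferInstance) t) le_sup_right
  have hall : ∀ᵐ ω ∂μ, ∀ k l : Fin d, Tendsto
      (fun n : ℕ => (n : ℝ)⁻¹ * ∑ t : Fin n, ψ (t : ℕ) ω k * φ ((σ n ω t : Fin n) : ℕ) ω l)
      atTop (𝓝 0) := ae_all_iff.mpr fun k => ae_all_iff.mpr fun l => hent k l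
  filter_upwards [hall] with ω hω
  exact tendsto_pi_nhds.mpr fun k => tendsto_pi_nhds.mpr fun l => hω k l

end
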